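/- Let H_0, H_1, ..., H_n be n+1 affine hyperplanes in ℝ^n in general position, meaning that for every subset S ⊆ {0, 1, ..., n} with |S| ≤ n the intersection ∩_{i∈S} H_i is an affine subspace of dimension n − |S|, and the intersection of all n+1 hyperplanes is empty. Then the complement ℝ^n \ (H_0 ∪ H_1 ∪ ⋯ ∪ H_n) has exactly 2^(n+1) − 1 connected components, and exactly one of these components is bounded. -/

import Mathlib

/-- The set of connected components of a subset `U` of `ℝ^n`, as subsets of `ℝ^n`. -/
def components {n : ℕ} (U : Set (Fin n → ℝ)) : Set (Set (Fin n → ℝ)) :=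
  {C | ∃ x ∈ U, C = connectedComponentIn U x}

section Orthants

variable {ι E : Type*} [NormedAddCommGroup E] [NormedSpace ℝ E]

/-- The points whose barycentric coordinates are positive on `S` and negative off `S`. -/
def AffineBasis.orthant (b : AffineBasis ι ℝ E) (S : Finset ι) : Set E :=
  {x | ∀ i, (i ∈ S → 0 < b.coord i x) ∧ (i ∉ S → b.coord i x < 0)}

theorem AffineBasis.convex_orthant (b : AffineBasis ι ℝ E) (S : Finset ι) :
    Convex ℝ (b.orthant S) := by
  have h : b.orthant S =
      ⋂ i, b.coord i ⁻¹' {y | (i ∈ S → 0 < y) ∧ (i ∉ S → y < 0)} := by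
    ext x
    simp [AffineBasis.orthant]
  rw [h]
  refine convex_iInter fun i => Convex.affine_preimage (b.coord i) ?_
  by_cases hi : i ∈ S
  · simp only [hi, not_true, true_imp_iff, false_imp_iff, and_true]
    exact convex_Ioi 0
  · simp only [hi, not_false_eq_true, true_imp_iff, false_imp_iff, true_and]
    exact convex_Iio 0

theorem AffineBasis.orthant_nonempty [Fintype ι] (b : AffineBasis ι ℝ E) {S : Finset ι}
    (hS : S.Nonempty) : (b.orthant S).Nonempty := by
  classical
  have hpos : (0 : ℝ) < S.card := by exact_mod_cast hS.card_pos
  let w : ι → ℝ := fun i => if i ∈ S then (1 + (Sᶜ).card) / S.card else -1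
  have hw : ∑ i, w i = 1 := by
    rw [← Finset.sum_add_sum_compl S w,
      Finset.sum_congr rfl (g := fun _ => (1 + ((Sᶜ).card : ℝ)) / S.card)
        (fun i hi => by simp [w, hi]),
      Finset.sum_congr (s₁ := Sᶜ) rfl (g := fun _ => (-1 : ℝ))
        (fun i hi => by simp [w, Finset.mem_compl.1 hi])]
    simp only [Finset.sum_const, nsmul_eq_mul]
    field_simp
    ring
  refine ⟨Finset.univ.affineCombination ℝ b w, fun i => ?_⟩
  rw [b.coord_apply_combination_of_mem (Finset.mem_univ i) hw]
  refine ⟨fun hi => ?_, fun hi => ?_⟩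
  · simp only [w, hi, if_true]
    positivity
  · simp [w, hi]

theorem AffineBasis.eq_of_mem_orthant (b : AffineBasis ι ℝ E) {S T : Finset ι} {x : E}
    (hS : x ∈ b.orthant S) (hT : x ∈ b.orthant T) : S = T := by
  ext i
  have h₁ := hS i
  have h₂ := hT i
  constructor
  · intro hi
    by_contra hj
    linarith [h₁.1 hi, h₂.2 hj]
  · intro hi
    by_contra hj
    linarith [h₂.1 hi, h₁.2 hj]

theorem AffineBasis.nonempty_of_mem_orthant [Fintype ι] (b : AffineBasis ι ℝ E) {S : Finset ι} {x : E}
    (hx : x ∈ b.orthant S) : S.Nonempty := by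
  by_contra h
  rw [Finset.not_nonempty_iff_eq_empty] at h
  subst h
  have h₁ : ∑ i, b.coord i x ≤ 0 := Finset.sum_nonpos fun i _ => ((hx i).2 (by simp)).le
  rw [b.sum_coord_apply_eq_one] at h₁
  linarith

theorem AffineBasis.exists_mem_orthant [Fintype ι] (b : AffineBasis ι ℝ E) {x : E}
    (hx : ∀ i, b.coord i x ≠ 0) : ∃ S, x ∈ b.orthant S := by
  classical
  refine ⟨Finset.univ.filter fun i => 0 < b.coord i x, fun i => ?_⟩
  simp only [Finset.mem_filter, Finset.mem_univ, true_and, imp_self, not_lt]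
  exact fun h => lt_of_le_of_ne h (hx i)

theorem AffineBasis.orthant_subset (b : AffineBasis ι ℝ E) (S : Finset ι) :
    b.orthant S ⊆ {x | ∀ i, b.coord i x ≠ 0} := by
  intro x hx i
  by_cases hi : i ∈ S
  · exact ((hx i).1 hi).ne'
  · exact ((hx i).2 hi).ne

theorem AffineBasis.connectedComponentIn_eq_orthant [FiniteDimensional ℝ E]
    (b : AffineBasis ι ℝ E) {S : Finset ι} {x : E} (hx : x ∈ b.orthant S) :
    connectedComponentIn {x | ∀ i, b.coord i x ≠ 0} x = b.orthant S := by
  apply Set.Subset.antisymm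
  · intro y hy
    have hsub := connectedComponentIn_subset {x | ∀ i, b.coord i x ≠ 0} x
    have hx' := mem_connectedComponentIn (b.orthant_subset S hx)
    have hpre : IsPreconnected (connectedComponentIn {x | ∀ i, b.coord i x ≠ 0} x) :=
      isPreconnected_connectedComponentIn
    intro i
    have hcont : Continuous (b.coord i) := (b.coord i).continuous_of_finiteDimensional
    constructor
    · intro hi
      by_contra hneg
      obtain ⟨z, hz, hz0⟩ := hpre.intermediate_value hy hx' hcont.continuousOn
        ⟨not_lt.1 hneg, ((hx i).1 hi).le⟩
      exact hsub hz i hz0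
    · intro hi
      by_contra hneg
      obtain ⟨z, hz, hz0⟩ := hpre.intermediate_value hx' hy hcont.continuousOn
        ⟨((hx i).2 hi).le, not_lt.1 hneg⟩
      exact hsub hz i hz0
  · exact (b.convex_orthant S).isPreconnected.subset_connectedComponentIn hx
      (b.orthant_subset S)

theorem AffineBasis.isBounded_orthant_univ [Fintype ι] (b : AffineBasis ι ℝ E) :
    Bornology.IsBounded (b.orthant Finset.univ) := by
  refine ((isBounded_convexHull (s := Set.range b)).2
    (Set.finite_range b).isBounded).subset fun x hx => ?_
  rw [b.convexHull_eq_nonneg_coord]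
  exact fun i => ((hx i).1 (Finset.mem_univ i)).le

theorem AffineBasis.eq_univ_of_isBounded_orthant [Fintype ι] (b : AffineBasis ι ℝ E) {S : Finset ι}
    (hS : S.Nonempty) (hb : Bornology.IsBounded (b.orthant S)) : S = Finset.univ := by
  classical
  by_contra hne
  obtain ⟨i, hi⟩ := hS
  obtain ⟨j, hj⟩ : ∃ j, j ∉ S := by
    by_contra! h
    exact hne (Finset.eq_univ_iff_forall.2 h)
  have hij : i ≠ j := fun h => hj (h ▸ hi)
  obtain ⟨x, hx⟩ := b.orthant_nonempty ⟨i, hi⟩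
  have hv : 0 < ‖b i - b j‖ := norm_pos_iff.2 (sub_ne_zero.2 fun h => hij (b.ind.injective h))
  have hray : ∀ t : ℝ, 0 ≤ t → t • (b i - b j) + x ∈ b.orthant S := by
    intro t ht k
    have hk : b.coord k (t • (b i - b j) + x) =
        t * ((if k = i then 1 else 0) - (if k = j then 1 else 0)) + b.coord k x := by
      rw [← vadd_eq_add, AffineMap.map_vadd, map_smul, ← vsub_eq_sub (b i),
        AffineMap.linearMap_vsub, b.coord_apply, b.coord_apply]
      simp
    rw [hk]
    constructor
    · intro hkS
      have hkj : k ≠ j := fun h => hj (h ▸ hkS)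
      have := (hx k).1 hkS
      simp only [hkj, if_false, sub_zero]
      split_ifs <;> linarith
    · intro hkS
      have hki : k ≠ i := fun h => hkS (h ▸ hi)
      have := (hx k).2 hkS
      simp only [hki, if_false, zero_sub]
      split_ifs <;> linarith
  obtain ⟨R, hR⟩ := hb.exists_norm_le
  have hR0 : 0 ≤ R := (norm_nonneg x).trans (hR x hx)
  have ht : 0 ≤ (R + ‖x‖ + 1) / ‖b i - b j‖ := by positivity
  have h₁ := hR _ (hray _ ht)
  have h₂ := norm_sub_le (((R + ‖x‖ + 1) / ‖b i - b j‖) • (b i - b j) + x) x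
  rw [add_sub_cancel_right, norm_smul, Real.norm_of_nonneg ht, div_mul_cancel₀ _ hv.ne'] at h₂
  linarith

end Orthants

theorem components_eq_image_orthant {n : ℕ} {ι : Type*} [Fintype ι]
    (b : AffineBasis ι ℝ (Fin n → ℝ)) :
    components {x | ∀ i, b.coord i x ≠ 0} = b.orthant '' {S | S.Nonempty} := by
  ext C
  constructor
  · rintro ⟨x, hx, rfl⟩
    obtain ⟨S, hS⟩ := b.exists_mem_orthant hx
    exact ⟨S, b.nonempty_of_mem_orthant hS, (b.connectedComponentIn_eq_orthant hS).symm⟩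
  · rintro ⟨S, hS, rfl⟩
    obtain ⟨x, hx⟩ := b.orthant_nonempty hS
    exact ⟨x, b.orthant_subset S hx, (b.connectedComponentIn_eq_orthant hx).symm⟩

theorem ncard_setOf_finset_nonempty (ι : Type*) [Fintype ι] :
    {S : Finset ι | S.Nonempty}.ncard = 2 ^ Fintype.card ι - 1 := by
  classical
  have h : {S : Finset ι | S.Nonempty} = {∅}ᶜ := by
    ext S
    simp [Finset.nonempty_iff_ne_empty]
  rw [h, Set.ncard_compl, Set.ncard_singleton, Nat.card_eq_fintype_card, Fintype.card_finset]

/-- If any `n` of `n + 1` hyperplanes meet, but all of them together do not, then they are the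
coordinate hyperplanes of an affine basis. -/
theorem exists_affineBasis_coord_eq_zero {n : ℕ} {H : Fin (n + 1) → Set (Fin n → ℝ)}
    (hH : ∀ i, ∃ (ℓ : (Fin n → ℝ) →ₗ[ℝ] ℝ) (c : ℝ), ℓ ≠ 0 ∧ H i = {x | ℓ x = c})
    (hvertex : ∀ i, ∃ p, ∀ j, j ≠ i → p ∈ H j) (hempty : (⋂ i, H i) = ∅) :
    ∃ b : AffineBasis (Fin (n + 1)) ℝ (Fin n → ℝ), ∀ i, H i = {x | b.coord i x = 0} := by
  choose ℓ c _ hℓ using hH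
  choose p hp using hvertex
  have hoff : ∀ i j, j ≠ i → ℓ j (p i) - c j = 0 := fun i j hij => by
    have := hp i j hij
    rw [hℓ] at this
    exact sub_eq_zero.2 this
  have hdiag : ∀ i, ℓ i (p i) - c i ≠ 0 := fun i h => by
    have : p i ∈ ⋂ j, H j := Set.mem_iInter.2 fun j => by
      by_cases hj : j = i
      · subst hj
        rw [hℓ]
        exact sub_eq_zero.1 h
      · exact hp i j hj
    rwa [hempty] at this
  have hind : AffineIndependent ℝ p := by
    rw [affineIndependent_iff]
    intro s w hw hsum i hi
    have h₁ : ∑ j ∈ s, w j * (ℓ i (p j) - c i) = 0 := by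
      have h₂ := congrArg (ℓ i) hsum
      simp only [map_sum, map_smul, smul_eq_mul, map_zero] at h₂
      simp only [mul_sub, Finset.sum_sub_distrib, ← Finset.sum_mul, h₂, hw, zero_mul, sub_zero]
    rw [Finset.sum_eq_single_of_mem i hi
      (fun j _ hj => by rw [hoff j i hj.symm, mul_zero])] at h₁
    exact (mul_eq_zero.1 h₁).resolve_right (hdiag i)
  have htop : affineSpan ℝ (Set.range p) = ⊤ := by
    rw [hind.affineSpan_eq_top_iff_card_eq_finrank_add_one]
    simp
  let b : AffineBasis (Fin (n + 1)) ℝ (Fin n → ℝ) := ⟨p, hind, htop⟩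
  refine ⟨b, fun i => ?_⟩
  have hcoord : ∀ x, ℓ i x - c i = (ℓ i (p i) - c i) * b.coord i x := by
    intro x
    have h := congrArg (ℓ i) (b.linear_combination_coord_eq_self x)
    simp only [map_sum, map_smul, smul_eq_mul] at h
    calc ℓ i x - c i = ∑ j, b.coord j x * (ℓ i (p j) - c i) := by
          rw [← h]
          simp only [mul_sub, Finset.sum_sub_distrib, ← Finset.sum_mul,
            b.sum_coord_apply_eq_one, one_mul]
          rfl
      _ = (ℓ i (p i) - c i) * b.coord i x := by
          rw [Finset.sum_eq_single_of_mem i (Finset.mem_univ i)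
            (fun j _ hj => by rw [hoff j i hj.symm, mul_zero]), mul_comm]
  ext x
  rw [hℓ, Set.mem_ofPred_eq, Set.mem_ofPred_eq, ← sub_eq_zero, hcoord, mul_eq_zero,
    or_iff_right (hdiag i)]

/-- If `H 0, …, H n` are `n + 1` affine hyperplanes in `ℝ^n` in general
position (every intersection of `|S| ≤ n` of them is an affine subspace of dimension
`n − |S|`, and the intersection of all of them is empty), then the complement of their
union has exactly `2^(n+1) − 1` connected components, exactly one of which is bounded. -/
theorem hyperplane_arrangement_components (n : ℕ) (H : Fin (n + 1) → Set (Fin n → ℝ))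
    (hH : ∀ i, ∃ (ℓ : (Fin n → ℝ) →ₗ[ℝ] ℝ) (c : ℝ), ℓ ≠ 0 ∧ H i = {x | ℓ x = c})
    (hgen : ∀ S : Finset (Fin (n + 1)), S.card ≤ n →
      ∃ E : AffineSubspace ℝ (Fin n → ℝ),
        (E : Set (Fin n → ℝ)) = ⋂ i ∈ S, H i ∧
        (E : Set (Fin n → ℝ)).Nonempty ∧
        Module.finrank ℝ E.direction = n - S.card)
    (hempty : (⋂ i, H i) = ∅) :
    (components (⋃ i, H i)ᶜ).Finite ∧
    (components (⋃ i, H i)ᶜ).ncard = 2 ^ (n + 1) - 1 ∧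
    ∃! C : Set (Fin n → ℝ), C ∈ components (⋃ i, H i)ᶜ ∧ Bornology.IsBounded C := by
  obtain ⟨b, hb⟩ := exists_affineBasis_coord_eq_zero hH (fun i => by
    obtain ⟨E, hE, ⟨p, hp⟩, -⟩ := hgen {i}ᶜ (by simp [Finset.card_compl])
    rw [hE] at hp
    exact ⟨p, fun j hj => Set.mem_iInter₂.1 hp j (by simpa using hj)⟩) hempty
  have hU : (⋃ i, H i)ᶜ = {x | ∀ i, b.coord i x ≠ 0} := by
    ext x
    simp [hb]
  rw [hU, components_eq_image_orthant]
  refine ⟨Set.toFinite _, ?_, b.orthant Finset.univ,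
    ⟨⟨_, Finset.univ_nonempty, rfl⟩, b.isBounded_orthant_univ⟩, ?_⟩
  · rw [Set.InjOn.ncard_image, ncard_setOf_finset_nonempty, Fintype.card_fin]
    intro S hS T _ hST
    obtain ⟨x, hx⟩ := b.orthant_nonempty hS
    exact b.eq_of_mem_orthant hx (hST ▸ hx)
  · rintro _ ⟨⟨S, hS, rfl⟩, hbd⟩
    rw [b.eq_univ_of_isBounded_orthant hS hbd]
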